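/- Let k ≥ 4 and let w be a word over Σ = {a,b}. Suppose v occurs in w at position s and u occurs in w at position s + k − 2 (so these two consecutive occurrences overlap, forming the factor b^{k−1} a^{k−1} of w). Let F_v and F_u be the sets of forbidden positions of these occurrences of v and u respectively. Then F_v ⊆ { (j − 2) mod k : j ∈ F_u } ∪ {0}. -/

import Mathlib

namespace Restivo

/-- Words over the two-letter alphabet Σ = {a, b}, encoded as lists of booleans. -/
abbrev Word := List Bool

/-- The letter `a`. -/
def a : Bool := false

/-- The letter `b`. -/
def b : Bool := true

/-- Kleene star: all finite concatenations of words from `S` (including the empty word). -/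
def kstar (S : Set Word) : Set Word :=
  { w | ∃ L : List Word, (∀ x ∈ L, x ∈ S) ∧ L.flatten = w }

/-- Prefixes of words of `L`. -/
def Pref (L : Set Word) : Set Word := { w | ∃ z : Word, w ++ z ∈ L }

/-- Factors (contiguous subwords) of words of `L`. -/
def Facts (L : Set Word) : Set Word := { w | ∃ x y : Word, x ++ w ++ y ∈ L }

/-- The word u = b a^(k-1). -/
def u (k : ℕ) : Word := b :: List.replicate (k - 1) a

/-- The word v = b^(k-1) a. -/
def v (k : ℕ) : Word := List.replicate (k - 1) b ++ [a]

/-- The set S_k = (Σ^k \ {u, v}) ∪ (Σ^(k-1) \ {a^(k-1), b^(k-1)}). -/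
def Sk (k : ℕ) : Set Word :=
  { w | w.length = k ∧ w ≠ u k ∧ w ≠ v k } ∪
  { w | w.length = k - 1 ∧ w ≠ List.replicate (k - 1) a ∧ w ≠ List.replicate (k - 1) b }

/-- Position `j` is forbidden in `w` w.r.t. `S` if the suffix of `w` starting from
position `j` is not a prefix of any word of `S*`. -/
def Forbidden (S : Set Word) (w : Word) (j : ℕ) : Prop :=
  w.drop j ∉ Pref (kstar S)

/-- The word `p` occurs in `w` at position `s`. -/
def OccursAt (p w : Word) (s : ℕ) : Prop :=
  s + p.length ≤ w.length ∧ (w.drop s).take p.length = p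

/-- The set of (locally enumerated) forbidden positions of the occurrence of `p`
at position `s` in `w`, with respect to `S_k`. -/
def Focc (k : ℕ) (w p : Word) (s : ℕ) : Set ℕ :=
  { i | i < p.length ∧ Forbidden (Sk k) w (s + i) }

/-- Two occurrences (of words from {u, v}) at positions `s < t` in `w` are
consecutive: no word from {u, v} occurs at a position strictly between them. -/
def Consecutive (k : ℕ) (w : Word) (s t : ℕ) : Prop :=
  s < t ∧ ∀ m, s < m → m < t → ¬ OccursAt (u k) w m ∧ ¬ OccursAt (v k) w m

/-- `w` is a minimal uncompletable word for `S`. -/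
def MinUncompletable (S : Set Word) (w : Word) : Prop :=
  w ∉ Facts (kstar S) ∧ ∀ w' : Word, w' ∉ Facts (kstar S) → w.length ≤ w'.length

theorem length_u {k : ℕ} (hk : 1 ≤ k) : (u k).length = k := by
  simp [u]; omega

theorem length_v {k : ℕ} (hk : 1 ≤ k) : (v k).length = k := by
  simp [v]; omega

theorem OccursAt.getElem? {p w : Word} {s m : ℕ} (h : OccursAt p w s) (hm : m < p.length) :
    w[s + m]? = p[m]? := by
  conv_rhs => rw [← h.2]
  rw [List.getElem?_take_of_lt hm, List.getElem?_drop]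

theorem append_mem_Pref_kstar {S : Set Word} {x y : Word} (hx : x ∈ S)
    (hy : y ∈ Pref (kstar S)) : x ++ y ∈ Pref (kstar S) := by
  obtain ⟨z, L, hL, hz⟩ := hy
  refine ⟨z, x :: L, ?_, by simp [hz]⟩
  intro t ht
  rcases List.mem_cons.mp ht with rfl | ht
  · exact hx
  · exact hL t ht

/-- A forbidden position stays forbidden after skipping a block that belongs to `S`. -/
theorem Forbidden.add {S : Set Word} {w : Word} {j n : ℕ} (h : Forbidden S w j)
    (hx : (w.drop j).take n ∈ S) : Forbidden S w (j + n) := by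
  intro hy
  apply h
  have := append_mem_Pref_kstar hx hy
  rwa [← List.drop_drop, List.take_append_drop] at this

/-- Inside the factor `b^(k-1) a^(k-1)` starting at `s`, the blocks of length `k` starting at
positions `s + 1, …, s + k - 3` belong to `S_k`. -/
theorem take_drop_mem_Sk {k : ℕ} {w : Word} {s i : ℕ}
    (hv : OccursAt (v k) w s) (hu : OccursAt (u k) w (s + (k - 2)))
    (hi : 1 ≤ i) (hik : i + 3 ≤ k) : (w.drop (s + i)).take k ∈ Sk k := by
  have hlu : (u k).length = k := length_u (by omega)
  have hlv : (v k).length = k := length_v (by omega)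
  have hlen := hu.1
  refine Or.inl ⟨by simp; omega, fun h => ?_, fun h => ?_⟩
  · have h1 := hv.getElem? (m := i + 1) (by omega)
    have h2 : w[s + i + 1]? = (u k)[1]? := by
      rw [← h, List.getElem?_take_of_lt (by omega), List.getElem?_drop]
    rw [add_assoc, h1, v, u, List.getElem?_append_left (by simp; omega), List.getElem?_cons_succ,
      List.getElem?_replicate_of_lt (by omega), List.getElem?_replicate_of_lt (by omega)] at h2
    simp [a, b] at h2
  · have h1 := hu.getElem? (m := (i - 1) + 1) (by omega)
    have h2 : w[s + i + (k - 2)]? = (v k)[k - 2]? := by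
      rw [← h, List.getElem?_take_of_lt (by omega), List.getElem?_drop]
    rw [show s + i + (k - 2) = s + (k - 2) + (i - 1 + 1) by omega, h1, v, u,
      List.getElem?_append_left (by simp; omega), List.getElem?_cons_succ,
      List.getElem?_replicate_of_lt (by omega), List.getElem?_replicate_of_lt (by omega)] at h2
    simp [a, b] at h2

theorem statement7 (k : ℕ) (hk : 4 ≤ k) (w : Word) (s : ℕ)
    (hv : OccursAt (v k) w s) (hu : OccursAt (u k) w (s + (k - 2)))
    (hcons : Consecutive k w s (s + (k - 2))) :
    Focc k w (v k) s ⊆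
      ((fun j => (j + (k - 2)) % k) '' Focc k w (u k) (s + (k - 2))) ∪ {0} := by
  rintro i ⟨hi, hf⟩
  have hlu : (u k).length = k := length_u (by omega)
  have hlv : (v k).length = k := length_v (by omega)
  rw [hlv] at hi
  rcases Nat.eq_zero_or_pos i with h0 | h0
  · exact Or.inr h0
  left
  by_cases hik : i + 3 ≤ k
  · refine ⟨i + 2, ⟨by omega, ?_⟩, ?_⟩
    · have := hf.add (take_drop_mem_Sk hv hu h0 hik)
      rwa [show s + i + k = s + (k - 2) + (i + 2) by omega] at this
    · change (i + 2 + (k - 2)) % k = i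
      rw [show i + 2 + (k - 2) = i + k by omega, Nat.add_mod_right, Nat.mod_eq_of_lt hi]
  · refine ⟨i - (k - 2), ⟨by omega, ?_⟩, ?_⟩
    · rwa [show s + (k - 2) + (i - (k - 2)) = s + i by omega]
    · change (i - (k - 2) + (k - 2)) % k = i
      rw [Nat.sub_add_cancel (by omega), Nat.mod_eq_of_lt hi]

end Restivo
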